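/- Let n ≥ 1, θ > 0 and let u : ℝⁿ → ℝ be C¹ on ℝⁿ and C³ on {|∇u| > 0}, satisfying div(∇u/√(1+|∇u|²)) = |∇u|^{θ} on all of ℝⁿ. Then u is constant. -/

import Mathlib

open Metric Real Filter

noncomputable def pd1 {n : ℕ} (u : EuclideanSpace ℝ (Fin n) → ℝ) (i : Fin n)
    (x : EuclideanSpace ℝ (Fin n)) : ℝ :=
  fderiv ℝ u x (EuclideanSpace.single i 1)

noncomputable def pd2 {n : ℕ} (u : EuclideanSpace ℝ (Fin n) → ℝ) (i j : Fin n)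
    (x : EuclideanSpace ℝ (Fin n)) : ℝ :=
  fderiv ℝ (pd1 u j) x (EuclideanSpace.single i 1)

/-- The coefficients `a^{ij} = δ^{ij} - u_i u_j / (1 + |∇u|²)` of the
nondivergence form of the mean curvature operator. -/
noncomputable def aCoef {n : ℕ} (u : EuclideanSpace ℝ (Fin n) → ℝ) (i j : Fin n)
    (x : EuclideanSpace ℝ (Fin n)) : ℝ :=
  (if i = j then (1 : ℝ) else 0) - pd1 u i x * pd1 u j x / (1 + ‖gradient u x‖ ^ 2)

/-- The mean curvature operator in nondivergence form: `a^{ij} u_{ij}`. -/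
noncomputable def mcOp {n : ℕ} (u : EuclideanSpace ℝ (Fin n) → ℝ)
    (x : EuclideanSpace ℝ (Fin n)) : ℝ :=
  ∑ i, ∑ j, aCoef u i j x * pd2 u i j x

/-- The second-order necessary condition at a local maximum. -/
theorem IsLocalMax.second_deriv_nonpos {f f' : ℝ → ℝ} {a f'' : ℝ} (hmax : IsLocalMax f a)
    (hf : ∀ᶠ t in nhds a, HasDerivAt f (f' t) t) (hf' : HasDerivAt f' f'' a) : f'' ≤ 0 := by
  by_contra! hpos
  have hd : deriv f =ᶠ[nhds a] f' := hf.mono fun t ht => ht.deriv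
  have hzero : deriv f a = 0 := hmax.deriv_eq_zero
  have hsecond : deriv (deriv f) a = f'' := by
    rw [hd.deriv_eq, hf'.deriv]
  have hmin : IsLocalMin f a := isLocalMin_of_deriv_deriv_pos (by rw [hsecond]; exact hpos) hzero
    hf.self_of_nhds.continuousAt
  have hconst : f =ᶠ[nhds a] fun _ => f a := by
    filter_upwards [hmax, hmin] with t h1 h2 using le_antisymm h1 h2
  have hconst' : deriv f =ᶠ[nhds a] fun _ => 0 := by
    simpa using hconst.deriv
  have : deriv (deriv f) a = 0 := by
    rw [hconst'.deriv_eq]; simp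
  linarith

/-- Conditions satisfied by `s` at a local maximum of `log s + k log ρ`. -/
theorem log_weighted_max_conditions {s s' ρ ρ' : ℝ → ℝ} {s'' ρ'' k : ℝ}
    (hmax : IsLocalMax (fun t => log (s t) + k * log (ρ t)) 0)
    (hs : ∀ᶠ t in nhds 0, HasDerivAt s (s' t) t) (hs' : HasDerivAt s' s'' 0)
    (hρ : ∀ᶠ t in nhds 0, HasDerivAt ρ (ρ' t) t) (hρ' : HasDerivAt ρ' ρ'' 0)
    (hs0 : 0 < s 0) (hρ0 : 0 < ρ 0) :
    s' 0 = - k * s 0 * ρ' 0 / ρ 0 ∧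
      s'' ≤ s 0 * ((k ^ 2 + k) * (ρ' 0) ^ 2 / (ρ 0) ^ 2 - k * ρ'' / ρ 0) := by
  have hsd := hs.self_of_nhds
  have hρd := hρ.self_of_nhds
  have hD : ∀ᶠ t in nhds 0, HasDerivAt (fun t => log (s t) + k * log (ρ t))
      (s' t / s t + k * (ρ' t / ρ t)) t := by
    filter_upwards [hs, hρ, hsd.continuousAt.eventually (lt_mem_nhds hs0),
      hρd.continuousAt.eventually (lt_mem_nhds hρ0)] with t h1 h2 h3 h4
    exact (h1.log h3.ne').add ((h2.log h4.ne').const_mul k)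
  have hD2 := (hs'.fun_div hsd hs0.ne').fun_add ((hρ'.fun_div hρd hρ0.ne').const_mul k)
  have h1 := hmax.hasDerivAt_eq_zero hD.self_of_nhds
  have h2 := hmax.second_deriv_nonpos hD hD2
  have h3 : s' 0 = - k * s 0 * ρ' 0 / ρ 0 := by
    field_simp at h1 ⊢
    linarith
  refine ⟨h3, ?_⟩
  rw [h3] at h2
  have h4 : (s'' * s 0 - -k * s 0 * ρ' 0 / ρ 0 * (-k * s 0 * ρ' 0 / ρ 0)) / s 0 ^ 2 +
      k * ((ρ'' * ρ 0 - ρ' 0 * ρ' 0) / ρ 0 ^ 2) =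
      (s'' - s 0 * ((k ^ 2 + k) * (ρ' 0) ^ 2 / (ρ 0) ^ 2 - k * ρ'' / ρ 0)) / s 0 := by
    field_simp
    ring
  rw [h4, div_le_iff₀ hs0] at h2
  linarith

section Algebra

variable {E ι : Type*} [NormedAddCommGroup E] [InnerProductSpace ℝ E] [Fintype ι]

/-- The contraction of a symmetric bilinear form with `I - G ⊗ G / (1 + |G|²)`, expressed through
the square root of this matrix. -/
theorem sum_bilin_sqrt_mcMatrix (b : OrthonormalBasis ι ℝ E) (B : E →L[ℝ] E →L[ℝ] ℝ)
    (hB : ∀ x y, B x y = B y x) (G : E) (c : ℝ)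
    (hc : 2 * c - c ^ 2 * ‖G‖ ^ 2 = 1 / (1 + ‖G‖ ^ 2)) :
    ∑ k, B (b k - (c * inner ℝ (b k) G) • G) (b k - (c * inner ℝ (b k) G) • G) =
      ∑ k, B (b k) (b k) - B G G / (1 + ‖G‖ ^ 2) := by
  have h1 : ∑ k, inner ℝ (b k) G * B (b k) G = B G G := by
    have h := congrArg (fun z => B z G) (b.sum_repr' G)
    simpa using h
  have h2 : ∑ k, (inner ℝ (b k) G) ^ 2 = ‖G‖ ^ 2 := by
    have h := b.sum_inner_mul_inner G G
    rw [real_inner_self_eq_norm_sq] at h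
    rw [← h]
    refine Finset.sum_congr rfl fun k _ => ?_
    rw [real_inner_comm G (b k), sq]
  have h3 : ∀ k, B (b k - (c * inner ℝ (b k) G) • G) (b k - (c * inner ℝ (b k) G) • G) =
      B (b k) (b k) - 2 * c * (inner ℝ (b k) G * B (b k) G) +
        c ^ 2 * B G G * (inner ℝ (b k) G) ^ 2 := by
    intro k
    simp only [map_sub, map_smul, sub_apply, smul_apply,
      smul_eq_mul]
    rw [hB G (b k)]
    ring
  simp only [h3, Finset.sum_add_distrib, Finset.sum_sub_distrib, ← Finset.mul_sum, h1, h2]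
  linear_combination - B G G * hc

theorem norm_sqrt_mcMatrix_column_le (b : OrthonormalBasis ι ℝ E) (G : E) (c : ℝ)
    (hc : 2 * c - c ^ 2 * ‖G‖ ^ 2 = 1 / (1 + ‖G‖ ^ 2)) (k : ι) :
    ‖b k - (c * inner ℝ (b k) G) • G‖ ≤ 1 := by
  have h : ‖b k - (c * inner ℝ (b k) G) • G‖ ^ 2 =
      1 - (1 / (1 + ‖G‖ ^ 2)) * (inner ℝ (b k) G) ^ 2 := by
    rw [norm_sub_sq_real, norm_smul, inner_smul_right, b.norm_eq_one, mul_pow, Real.norm_eq_abs,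
      sq_abs, ← hc]
    ring
  have h' : 0 ≤ (1 / (1 + ‖G‖ ^ 2)) * (inner ℝ (b k) G) ^ 2 := by positivity
  nlinarith [norm_nonneg (b k - (c * inner ℝ (b k) G) • G)]

theorem exists_sqrt_mcMatrix_coeff (v : ℝ) (hv : 0 ≤ v) :
    ∃ c : ℝ, 2 * c - c ^ 2 * v = 1 / (1 + v) := by
  have hr : 0 < √(1 + v) := Real.sqrt_pos.mpr (by linarith)
  have hr2 : √(1 + v) ^ 2 = 1 + v := Real.sq_sqrt (by linarith)
  refine ⟨1 / (√(1 + v) * (√(1 + v) + 1)), ?_⟩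
  have hv' : v = √(1 + v) ^ 2 - 1 := by linarith
  generalize √(1 + v) = r at *
  subst hv'
  have : (1 + (r ^ 2 - 1)) = r ^ 2 := by ring
  rw [this]
  field_simp
  ring

/-- The contraction of `D²|∇u|²` with the mean curvature coefficients is bounded below, where `H`
and `T` are the second and third derivatives of `u` and `G` is its gradient. -/
theorem bochner_lower_bound (b : OrthonormalBasis ι ℝ E) (A : E →L[ℝ] E)
    (H : E →L[ℝ] E →L[ℝ] ℝ) (T : E →L[ℝ] E →L[ℝ] E →L[ℝ] ℝ) (G : E) (c g g' : ℝ)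
    (hA : ∀ x y, inner ℝ (A x) y = H x y) (hH : ∀ x y, H x y = H y x)
    (hT1 : ∀ x y z, T x y z = T y x z) (hT2 : ∀ x y z, T x y z = T x z y)
    (hc : 2 * c - c ^ 2 * ‖G‖ ^ 2 = 1 / (1 + ‖G‖ ^ 2))
    (heq : ∑ k, H (b k) (b k) - H G G / (1 + ‖G‖ ^ 2) = g)
    (hdeq : ∑ k, T G (b k) (b k) - ((T G G G + 2 * ‖A G‖ ^ 2) * (1 + ‖G‖ ^ 2)
      - H G G * (2 * H G G)) / (1 + ‖G‖ ^ 2) ^ 2 = g' * (2 * H G G)) :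
    4 * g' * H G G * Fintype.card ι + 2 * g ^ 2 ≤ Fintype.card ι *
      ∑ k, (2 * T (b k - (c * inner ℝ (b k) G) • G) (b k - (c * inner ℝ (b k) G) • G) G +
        2 * ‖A (b k - (c * inner ℝ (b k) G) • G)‖ ^ 2) := by
  set w : ι → E := fun k => b k - (c * inner ℝ (b k) G) • G with hw
  have hrot : ∀ x y, T x y G = T G x y := fun x y => by rw [hT2 x y G, hT1 x G y]
  have hwT : ∑ k, T (w k) (w k) G = ∑ k, T G (b k) (b k) - T G G G / (1 + ‖G‖ ^ 2) := by
    simp only [hrot]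
    exact sum_bilin_sqrt_mcMatrix b (T G) (hT2 G) G c hc
  have hwH : ∑ k, H (w k) (w k) = g := by
    rw [← heq]
    exact sum_bilin_sqrt_mcMatrix b H hH G c hc
  have hcs : g ^ 2 ≤ Fintype.card ι * ∑ k, ‖A (w k)‖ ^ 2 := by
    rw [← hwH]
    refine sq_sum_le_card_mul_sum_sq.trans ?_
    rw [Finset.card_univ]
    refine mul_le_mul_of_nonneg_left (Finset.sum_le_sum fun k _ => ?_) (Nat.cast_nonneg _)
    rw [← hA]
    have h1 := abs_real_inner_le_norm (A (w k)) (w k)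
    have h2 := norm_sqrt_mcMatrix_column_le b G c hc k
    have h3 : |inner ℝ (A (w k)) (w k)| ≤ ‖A (w k)‖ :=
      h1.trans (mul_le_of_le_one_right (norm_nonneg _) h2)
    rw [← sq_abs]
    gcongr
  have hAG : (H G G) ^ 2 ≤ ‖A G‖ ^ 2 * ‖G‖ ^ 2 := by
    have h1 := abs_real_inner_le_norm (A G) G
    rw [← hA, ← sq_abs, ← mul_pow]
    gcongr
  have hTl : 2 * g' * H G G ≤ ∑ k, T (w k) (w k) G := by
    rw [hwT]
    have h1 : ((T G G G + 2 * ‖A G‖ ^ 2) * (1 + ‖G‖ ^ 2) - H G G * (2 * H G G))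
        / (1 + ‖G‖ ^ 2) ^ 2 = T G G G / (1 + ‖G‖ ^ 2) +
        2 * (‖A G‖ ^ 2 * (1 + ‖G‖ ^ 2) - (H G G) ^ 2) / (1 + ‖G‖ ^ 2) ^ 2 := by
      field_simp
      ring
    have h2 : 0 ≤ 2 * (‖A G‖ ^ 2 * (1 + ‖G‖ ^ 2) - (H G G) ^ 2) / (1 + ‖G‖ ^ 2) ^ 2 := by
      apply div_nonneg _ (by positivity)
      nlinarith [sq_nonneg ‖A G‖]
    rw [h1] at hdeq
    linarith
  rw [Finset.sum_add_distrib, ← Finset.mul_sum, ← Finset.mul_sum]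
  have hn : (0 : ℝ) ≤ Fintype.card ι := by positivity
  nlinarith [mul_le_mul_of_nonneg_left hTl hn]

end Algebra

/-- A function of the squared gradient that appears on the right-hand side, with its derivative. -/
theorem hasDerivAt_sqrt_one_add_mul_rpow {θ v : ℝ} (hθ : 0 < θ) (hv : 0 < v) :
    ∃ g' : ℝ, HasDerivAt (fun s : ℝ => √(1 + s) * s ^ (θ / 2)) g' v ∧ 0 ≤ g' ∧
      g' * v ≤ (θ + 1) / 2 * (√(1 + v) * v ^ (θ / 2)) := by
  have hr : 0 < √(1 + v) := Real.sqrt_pos.mpr (by linarith)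
  have hr2 : √(1 + v) ^ 2 = 1 + v := Real.sq_sqrt (by linarith)
  have hp : 0 < v ^ (θ / 2) := Real.rpow_pos_of_pos hv _
  have hp1 : v ^ (θ / 2 - 1) * v = v ^ (θ / 2) := by
    rw [Real.rpow_sub_one hv.ne']; field_simp
  have hp1' : 0 < v ^ (θ / 2 - 1) := Real.rpow_pos_of_pos hv _
  have h1 : HasDerivAt (fun s : ℝ => √(1 + s)) (1 / (2 * √(1 + v))) v :=
    ((hasDerivAt_id' v).const_add 1).sqrt (by linarith)
  have h2 : HasDerivAt (fun s : ℝ => s ^ (θ / 2)) (θ / 2 * v ^ (θ / 2 - 1)) v :=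
    Real.hasDerivAt_rpow_const (Or.inl hv.ne')
  refine ⟨_, h1.fun_mul h2, by positivity, ?_⟩
  have h3 : 1 / (2 * √(1 + v)) * v ≤ √(1 + v) / 2 := by
    rw [div_mul_eq_mul_div, div_le_iff₀ (by positivity)]
    nlinarith
  calc (1 / (2 * √(1 + v)) * v ^ (θ / 2) + √(1 + v) * (θ / 2 * v ^ (θ / 2 - 1))) * v
      = (1 / (2 * √(1 + v)) * v) * v ^ (θ / 2) +
        √(1 + v) * (θ / 2 * (v ^ (θ / 2 - 1) * v)) := by ring
    _ ≤ √(1 + v) / 2 * v ^ (θ / 2) + √(1 + v) * (θ / 2 * v ^ (θ / 2)) := by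
        rw [hp1]; gcongr
    _ = _ := by ring

/-- The computation that turns the first and second order conditions at the maximum into a bound
on the gradient. -/
theorem weighted_gradient_arithmetic {r ρ n k θ R g' Q I : ℝ} (hr : 0 < r) (hρ0 : 0 < ρ)
    (hn0 : 0 ≤ n) (hk : 0 ≤ k) (hg'0 : 0 ≤ g')
    (hg'v : g' * r ^ 2 ≤ (θ + 1) / 2 * (√(1 + r ^ 2) * (r ^ 2) ^ (θ / 2)))
    (hfirst : 2 * Q = -k * r ^ 2 * (-2 * I) / ρ) (hI : -I ≤ R * r)
    (hsecond : 4 * g' * Q * n + 2 * (√(1 + r ^ 2) * (r ^ 2) ^ (θ / 2)) ^ 2 ≤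
      n * (n * (r ^ 2 * R ^ 2 / ρ ^ 2 * (4 * k ^ 2 + 6 * k)))) (hR : 0 < R) :
    (r ^ 2) ^ θ * ρ ^ 2 ≤
      ((n * (θ + 1) * k) ^ 2 + n ^ 2 * (4 * k ^ 2 + 6 * k)) * R ^ 2 := by
  have hg2 : r ^ 2 * (r ^ 2) ^ θ ≤ (√(1 + r ^ 2) * (r ^ 2) ^ (θ / 2)) ^ 2 := by
    have h1 : ((r ^ 2) ^ (θ / 2)) ^ 2 = (r ^ 2) ^ θ := by
      rw [← Real.rpow_natCast, ← Real.rpow_mul (sq_nonneg r)]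
      congr 1
      push_cast
      ring
    rw [mul_pow, Real.sq_sqrt (by positivity), h1]
    gcongr
    linarith
  have hg0 : 0 ≤ √(1 + r ^ 2) * (r ^ 2) ^ (θ / 2) := by positivity
  generalize √(1 + r ^ 2) * (r ^ 2) ^ (θ / 2) = g at *
  generalize (r ^ 2) ^ θ = p at *
  have hQ : -(g' * Q) * ρ ≤ (θ + 1) / 2 * g * (k * R * r) := by
    have h1 : Q * ρ = k * r ^ 2 * I := by
      have := hfirst
      field_simp at this
      linarith
    calc -(g' * Q) * ρ = g' * r ^ 2 * (k * -I) := by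
          linear_combination -g' * h1
      _ ≤ g' * r ^ 2 * (k * (R * r)) := by gcongr
      _ ≤ (θ + 1) / 2 * g * (k * (R * r)) := by gcongr
      _ = _ := by ring
  have hmain : 2 * (g * ρ) ^ 2 ≤ 2 * (n * (θ + 1) * k) * (g * ρ) * (R * r) +
      n ^ 2 * (4 * k ^ 2 + 6 * k) * (R * r) ^ 2 := by
    have h1 := mul_le_mul_of_nonneg_right hsecond
      (sq_nonneg ρ)
    have h2 := mul_le_mul_of_nonneg_left hQ (by positivity : 0 ≤ 4 * n * ρ)
    have h3 : n * (n * (r ^ 2 * R ^ 2 / ρ ^ 2 * (4 * k ^ 2 + 6 * k))) * ρ ^ 2 =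
        n ^ 2 * (4 * k ^ 2 + 6 * k) * (R * r) ^ 2 := by
      field_simp
    rw [h3] at h1
    linarith
  have hY : (g * ρ) ^ 2 ≤
      ((n * (θ + 1) * k) ^ 2 + n ^ 2 * (4 * k ^ 2 + 6 * k)) * (R * r) ^ 2 := by
    nlinarith [sq_nonneg (g * ρ - n * (θ + 1) * k * (R * r))]
  have hfin : r ^ 2 * (p * ρ ^ 2) ≤
      r ^ 2 * (((n * (θ + 1) * k) ^ 2 + n ^ 2 * (4 * k ^ 2 + 6 * k)) * R ^ 2) := by
    calc r ^ 2 * (p * ρ ^ 2) = r ^ 2 * p * ρ ^ 2 := by ring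
      _ ≤ g ^ 2 * ρ ^ 2 := by gcongr
      _ = (g * ρ) ^ 2 := by ring
      _ ≤ _ := hY
      _ = _ := by ring
  exact le_of_mul_le_mul_left hfin (by positivity : (0:ℝ) < r ^ 2)

section Calculus

variable {E ι : Type*} [NormedAddCommGroup E] [InnerProductSpace ℝ E] [Fintype ι]
  {u : E → ℝ} {x : E}

theorem ContDiffAt.hasFDerivAt_fderiv (h : ContDiffAt ℝ 3 u x) :
    HasFDerivAt (fderiv ℝ u) (fderiv ℝ (fderiv ℝ u) x) x :=
  ((h.fderiv_right (m := 2) (by norm_num)).differentiableAt (by norm_num)).hasFDerivAt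

theorem ContDiffAt.hasFDerivAt_fderiv_fderiv (h : ContDiffAt ℝ 3 u x) :
    HasFDerivAt (fderiv ℝ (fderiv ℝ u)) (fderiv ℝ (fderiv ℝ (fderiv ℝ u)) x) x :=
  (((h.fderiv_right (m := 2) (by norm_num)).fderiv_right (m := 1)
    (by norm_num)).differentiableAt (by norm_num)).hasFDerivAt

theorem ContDiffAt.second_fderiv_symm (h : ContDiffAt ℝ 3 u x) (y z : E) :
    fderiv ℝ (fderiv ℝ u) x y z = fderiv ℝ (fderiv ℝ u) x z y :=
  h.isSymmSndFDerivAt (by simp; norm_num) y z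

theorem ContDiffAt.third_fderiv_symm_left (h : ContDiffAt ℝ 3 u x) (y z w : E) :
    fderiv ℝ (fderiv ℝ (fderiv ℝ u)) x y z w = fderiv ℝ (fderiv ℝ (fderiv ℝ u)) x z y w := by
  have h2 : ContDiffAt ℝ 2 (fderiv ℝ u) x := h.fderiv_right (by norm_num)
  exact congrArg (fun f => f w) (h2.isSymmSndFDerivAt (by simp) y z)

theorem hasDerivAt_line (x w : E) (t : ℝ) : HasDerivAt (fun t : ℝ => x + t • w) w t := by
  simpa using ((hasDerivAt_id' t).smul_const w).const_add x

theorem tendsto_line (x w : E) : Tendsto (fun t : ℝ => x + t • w) (nhds 0) (nhds x) := by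
  simpa using (hasDerivAt_line x w 0).continuousAt.tendsto

theorem ContDiffAt.hasDerivAt_hessian_line {t : ℝ} {w : E} (h : ContDiffAt ℝ 3 u (x + t • w)) :
    HasDerivAt (fun t : ℝ => fderiv ℝ (fderiv ℝ u) (x + t • w))
      (fderiv ℝ (fderiv ℝ (fderiv ℝ u)) (x + t • w) w) t :=
  HasFDerivAt.comp_hasDerivAt (E := E →L[ℝ] E →L[ℝ] ℝ) t h.hasFDerivAt_fderiv_fderiv
    (hasDerivAt_line x w t)

theorem ContDiffAt.third_fderiv_symm_right (h : ContDiffAt ℝ 3 u x) (y z w : E) :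
    fderiv ℝ (fderiv ℝ (fderiv ℝ u)) x y z w = fderiv ℝ (fderiv ℝ (fderiv ℝ u)) x y w z := by
  have h0 : ContDiffAt ℝ 3 u (x + (0 : ℝ) • y) := by simpa using h
  have h1 (z w : E) : HasDerivAt (fun t : ℝ => fderiv ℝ (fderiv ℝ u) (x + t • y) z w)
      (fderiv ℝ (fderiv ℝ (fderiv ℝ u)) x y z w) 0 := by
    simpa using (h0.hasDerivAt_hessian_line.clm_apply (hasDerivAt_const 0 z)).clm_apply
      (hasDerivAt_const 0 w)
  have h2 : (fun t : ℝ => fderiv ℝ (fderiv ℝ u) (x + t • y) z w) =ᶠ[nhds 0]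
      fun t : ℝ => fderiv ℝ (fderiv ℝ u) (x + t • y) w z := by
    filter_upwards [(tendsto_line x y).eventually (h.eventually (by simp))] with t ht
      using ht.second_fderiv_symm z w
  exact (h1 z w).unique ((h1 w z).congr_of_eventuallyEq h2)

variable [CompleteSpace E]

/-- The Riesz isomorphism from the dual of a real Hilbert space, as a linear map. -/
noncomputable def rieszMap (E : Type*) [NormedAddCommGroup E] [InnerProductSpace ℝ E]
    [CompleteSpace E] : StrongDual ℝ E →L[ℝ] E where
  toFun := (InnerProductSpace.toDual ℝ E).symm
  map_add' := map_add _
  map_smul' r f := by simp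
  cont := (InnerProductSpace.toDual ℝ E).symm.continuous

/-- The Hessian of a function as an endomorphism. -/
noncomputable def hessianMap (u : E → ℝ) (x : E) : E →L[ℝ] E :=
  rieszMap E ∘L fderiv ℝ (fderiv ℝ u) x

theorem inner_hessianMap (u : E → ℝ) (x y z : E) :
    inner ℝ (hessianMap u x y) z = fderiv ℝ (fderiv ℝ u) x y z :=
  InnerProductSpace.toDual_symm_apply

theorem ContDiffAt.hasFDerivAt_gradient (h : ContDiffAt ℝ 3 u x) :
    HasFDerivAt (gradient u) (hessianMap u x) x :=
  (rieszMap E).hasFDerivAt.comp x h.hasFDerivAt_fderiv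

/-- First derivative of the squared gradient along a line. -/
theorem ContDiffAt.hasDerivAt_norm_gradient_sq {t : ℝ} {w : E}
    (h : ContDiffAt ℝ 3 u (x + t • w)) :
    HasDerivAt (fun t : ℝ => ‖gradient u (x + t • w)‖ ^ 2)
      (2 * fderiv ℝ (fderiv ℝ u) (x + t • w) w (gradient u (x + t • w))) t := by
  have h1 := (h.hasFDerivAt_gradient.comp_hasDerivAt t (hasDerivAt_line x w t)).norm_sq
  rw [real_inner_comm, inner_hessianMap] at h1
  exact h1

/-- Derivative of `D²u(y, ∇u)` along a line. -/
theorem ContDiffAt.hasDerivAt_hessian_gradient (h : ContDiffAt ℝ 3 u x) (w : E) {y : ℝ → E} {y' : E}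
    (hy : HasDerivAt y y' 0) :
    HasDerivAt (fun t : ℝ => fderiv ℝ (fderiv ℝ u) (x + t • w) (y t) (gradient u (x + t • w)))
      (fderiv ℝ (fderiv ℝ (fderiv ℝ u)) x w (y 0) (gradient u x) +
        fderiv ℝ (fderiv ℝ u) x y' (gradient u x) +
        fderiv ℝ (fderiv ℝ u) x (y 0) (hessianMap u x w)) 0 := by
  have h0 : ContDiffAt ℝ 3 u (x + (0 : ℝ) • w) := by simpa using h
  have h1 := h0.hasFDerivAt_gradient.comp_hasDerivAt 0 (hasDerivAt_line x w 0)
  have h2 := h0.hasDerivAt_hessian_line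
  simpa using (h2.clm_apply hy).clm_apply h1

/-- Derivative of the mean curvature operator in the direction of the gradient. -/
theorem ContDiffAt.hasDerivAt_mc_along_gradient (h : ContDiffAt ℝ 3 u x)
    (b : OrthonormalBasis ι ℝ E) :
    HasDerivAt (fun t : ℝ => ∑ k, fderiv ℝ (fderiv ℝ u) (x + t • gradient u x) (b k) (b k) -
        fderiv ℝ (fderiv ℝ u) (x + t • gradient u x) (gradient u (x + t • gradient u x))
          (gradient u (x + t • gradient u x)) / (1 + ‖gradient u (x + t • gradient u x)‖ ^ 2))
      (∑ k, fderiv ℝ (fderiv ℝ (fderiv ℝ u)) x (gradient u x) (b k) (b k) -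
        ((fderiv ℝ (fderiv ℝ (fderiv ℝ u)) x (gradient u x) (gradient u x) (gradient u x) +
            2 * ‖hessianMap u x (gradient u x)‖ ^ 2) * (1 + ‖gradient u x‖ ^ 2) -
          fderiv ℝ (fderiv ℝ u) x (gradient u x) (gradient u x) *
            (2 * fderiv ℝ (fderiv ℝ u) x (gradient u x) (gradient u x))) /
          (1 + ‖gradient u x‖ ^ 2) ^ 2) 0 := by
  set G := gradient u x with hG
  have h0 : ContDiffAt ℝ 3 u (x + (0 : ℝ) • G) := by simpa using h
  have h1 := h0.hasFDerivAt_gradient.comp_hasDerivAt 0 (hasDerivAt_line x G 0)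
  have h2 := h0.hasDerivAt_hessian_line
  have h3 : HasDerivAt (fun t : ℝ => ∑ k, fderiv ℝ (fderiv ℝ u) (x + t • G) (b k) (b k))
      (∑ k, fderiv ℝ (fderiv ℝ (fderiv ℝ u)) x G (b k) (b k)) 0 := by
    refine HasDerivAt.fun_sum fun k _ => ?_
    simpa using (h2.clm_apply (hasDerivAt_const 0 (b k))).clm_apply (hasDerivAt_const 0 (b k))
  have h4 := h.hasDerivAt_hessian_gradient G h1
  have h5 := h0.hasDerivAt_norm_gradient_sq.const_add 1
  have h6 := h3.fun_sub (h4.fun_div h5 (by positivity))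
  have h7 : fderiv ℝ (fderiv ℝ u) x (hessianMap u x G) G = ‖hessianMap u x G‖ ^ 2 := by
    rw [h.second_fderiv_symm, ← inner_hessianMap, real_inner_self_eq_norm_sq]
  have h8 : fderiv ℝ (fderiv ℝ u) x G (hessianMap u x G) = ‖hessianMap u x G‖ ^ 2 := by
    rw [← inner_hessianMap, real_inner_self_eq_norm_sq]
  refine h6.congr_deriv ?_
  simp only [zero_smul, add_zero, Function.comp_apply, ← hG, h7, h8]
  ring

/-- The geometric content of a maximum of `|∇u|² ρ^k` on a ball. -/
theorem gradient_bound_at_weighted_max (b : OrthonormalBasis ι ℝ E) {θ k R : ℝ} (hθ : 0 < θ)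
    (hk : 0 ≤ k) (hxR : ‖x‖ < R) (hG : gradient u x ≠ 0) (h : ContDiffAt ℝ 3 u x)
    (heq : ∀ᶠ y in nhds x, ∑ i, fderiv ℝ (fderiv ℝ u) y (b i) (b i) -
      fderiv ℝ (fderiv ℝ u) y (gradient u y) (gradient u y) / (1 + ‖gradient u y‖ ^ 2) =
        √(1 + ‖gradient u y‖ ^ 2) * (‖gradient u y‖ ^ 2) ^ (θ / 2))
    (hmax : IsLocalMax (fun y => log (‖gradient u y‖ ^ 2) + k * log (R ^ 2 - ‖y‖ ^ 2)) x) :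
    (‖gradient u x‖ ^ 2) ^ θ * (R ^ 2 - ‖x‖ ^ 2) ^ 2 ≤
      ((Fintype.card ι * (θ + 1) * k) ^ 2 + Fintype.card ι ^ 2 * (4 * k ^ 2 + 6 * k)) * R ^ 2 := by
  set G := gradient u x with hGdef
  set H := fderiv ℝ (fderiv ℝ u) x with hH
  set T := fderiv ℝ (fderiv ℝ (fderiv ℝ u)) x with hT
  set A := hessianMap u x with hA
  set v := ‖G‖ ^ 2 with hv
  set ρ := R ^ 2 - ‖x‖ ^ 2 with hρ
  set n : ℝ := (Fintype.card ι : ℝ) with hn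
  have hv0 : 0 < v := by positivity
  have hR : 0 < R := (norm_nonneg x).trans_lt hxR
  have hρ0 : 0 < ρ := by nlinarith [norm_nonneg x]
  have hρR : ρ ≤ R ^ 2 := by nlinarith [sq_nonneg ‖x‖]
  have hn0 : 0 ≤ n := Nat.cast_nonneg _
  have hline (w : E) : 2 * H w G = - k * v * (-2 * inner ℝ x w) / ρ ∧
      2 * T w w G + 2 * ‖A w‖ ^ 2 ≤
        v * ((k ^ 2 + k) * (-2 * inner ℝ x w) ^ 2 / ρ ^ 2 - k * (-2 * ‖w‖ ^ 2) / ρ) := by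
    have hm : IsLocalMax (fun t : ℝ => log (‖gradient u (x + t • w)‖ ^ 2) +
        k * log (R ^ 2 - ‖x + t • w‖ ^ 2)) 0 := by
      have := (tendsto_line x w).eventually hmax
      simpa [IsLocalMax, IsMaxFilter] using this
    have hs : ∀ᶠ t in nhds (0 : ℝ), HasDerivAt (fun t : ℝ => ‖gradient u (x + t • w)‖ ^ 2)
        (2 * fderiv ℝ (fderiv ℝ u) (x + t • w) w (gradient u (x + t • w))) t := by
      filter_upwards [(tendsto_line x w).eventually (h.eventually (by simp))] with t ht
        using ht.hasDerivAt_norm_gradient_sq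
    have hs' : HasDerivAt
        (fun t : ℝ => 2 * fderiv ℝ (fderiv ℝ u) (x + t • w) w (gradient u (x + t • w)))
        (2 * T w w G + 2 * ‖A w‖ ^ 2) 0 := by
      refine ((h.hasDerivAt_hessian_gradient w (hasDerivAt_const 0 w)).const_mul 2).congr_deriv ?_
      rw [← real_inner_self_eq_norm_sq (A w), hA, inner_hessianMap]
      simp only [map_zero, zero_apply, add_zero]
      ring
    have hr : ∀ᶠ t in nhds (0 : ℝ), HasDerivAt (fun t : ℝ => R ^ 2 - ‖x + t • w‖ ^ 2)
        (-2 * inner ℝ (x + t • w) w) t := by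
      refine Eventually.of_forall fun t => ?_
      exact ((hasDerivAt_line x w t).norm_sq.const_sub (R ^ 2)).congr_deriv (by ring)
    have hr' : HasDerivAt (fun t : ℝ => -2 * inner ℝ (x + t • w) w) (-2 * ‖w‖ ^ 2) 0 := by
      refine (((hasDerivAt_line x w 0).inner ℝ (hasDerivAt_const 0 w)).const_mul
        (-2)).congr_deriv ?_
      simp
    have := log_weighted_max_conditions hm hs hs' hr hr' (by simpa using hv0) 
      (by rw [zero_smul, add_zero]; exact hρ0)
    simpa only [zero_smul, add_zero] using this
  obtain ⟨c, hc⟩ := exists_sqrt_mcMatrix_coeff v hv0.le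
  obtain ⟨g', hg', hg'0, hg'v⟩ := hasDerivAt_sqrt_one_add_mul_rpow hθ hv0
  set g := √(1 + v) * v ^ (θ / 2) with hg
  have hg0 : 0 ≤ g := by positivity
  have hdeq := (h.hasDerivAt_mc_along_gradient b).unique (HasDerivAt.congr_of_eventuallyEq
    (f := fun t : ℝ => √(1 + ‖gradient u (x + t • G)‖ ^ 2) *
      (‖gradient u (x + t • G)‖ ^ 2) ^ (θ / 2)) (f' := g' * (2 * H G G)) (by
    have h0 : ContDiffAt ℝ 3 u (x + (0 : ℝ) • G) := by simpa using h
    have h1 := h0.hasDerivAt_norm_gradient_sq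
    have h2 : HasDerivAt (fun s : ℝ => √(1 + s) * s ^ (θ / 2)) g'
        (‖gradient u (x + (0 : ℝ) • G)‖ ^ 2) := by simpa using hg'
    refine (h2.comp 0 h1).congr_deriv ?_
    simp only [zero_smul, add_zero]
    rfl) ((tendsto_line x G).eventually heq))
  have hlow := bochner_lower_bound b A H T G c g g' (inner_hessianMap u x) h.second_fderiv_symm
    h.third_fderiv_symm_left h.third_fderiv_symm_right hc heq.self_of_nhds hdeq
  have hup (w : E) (hw : ‖w‖ ≤ 1) :
      2 * T w w G + 2 * ‖A w‖ ^ 2 ≤ v * R ^ 2 / ρ ^ 2 * (4 * k ^ 2 + 6 * k) := by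
    refine (hline w).2.trans ?_
    have h1 : (inner ℝ x w) ^ 2 ≤ R ^ 2 := by
      have h2 : |inner ℝ x w| ≤ R := (abs_real_inner_le_norm x w).trans (by
        nlinarith [norm_nonneg x, norm_nonneg w])
      rw [← sq_abs]
      gcongr
    have h2 : ‖w‖ ^ 2 * ρ ≤ R ^ 2 := by
      nlinarith [norm_nonneg w, pow_le_one₀ (norm_nonneg w) hw (n := 2)]
    calc v * ((k ^ 2 + k) * (-2 * inner ℝ x w) ^ 2 / ρ ^ 2 - k * (-2 * ‖w‖ ^ 2) / ρ)
        = v / ρ ^ 2 * (4 * (k ^ 2 + k) * (inner ℝ x w) ^ 2 + 2 * k * (‖w‖ ^ 2 * ρ)) := by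
          field_simp
          ring
      _ ≤ v / ρ ^ 2 * (4 * (k ^ 2 + k) * R ^ 2 + 2 * k * R ^ 2) := by gcongr
      _ = _ := by ring
  have hsum : ∑ i, (2 * T (b i - (c * inner ℝ (b i) G) • G) (b i - (c * inner ℝ (b i) G) • G) G +
        2 * ‖A (b i - (c * inner ℝ (b i) G) • G)‖ ^ 2) ≤
      n * (v * R ^ 2 / ρ ^ 2 * (4 * k ^ 2 + 6 * k)) := by
    refine (Finset.sum_le_card_nsmul _ _ _ fun i _ =>
      hup _ (norm_sqrt_mcMatrix_column_le b G c hc i)).trans_eq ?_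
    rw [nsmul_eq_mul, Finset.card_univ]
  have hI : -inner ℝ x G ≤ R * ‖G‖ := by
    exact (neg_le_abs _).trans ((abs_real_inner_le_norm x G).trans
      (mul_le_mul_of_nonneg_right hxR.le (norm_nonneg G)))
  exact weighted_gradient_arithmetic (norm_pos_iff.mpr hG) hρ0 hn0 hk hg'0 hg'v (hline G).1 hI
    (hlow.trans (mul_le_mul_of_nonneg_left hsum hn0)) hR

end Calculus

/-- The mean curvature operator in terms of the second derivative as a bilinear form. -/
theorem mcOp_eq_sum_fderiv {n : ℕ} {u : EuclideanSpace ℝ (Fin n) → ℝ}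
    {x : EuclideanSpace ℝ (Fin n)} (h : ContDiffAt ℝ 3 u x) :
    mcOp u x = ∑ i, fderiv ℝ (fderiv ℝ u) x (EuclideanSpace.basisFun (Fin n) ℝ i)
        (EuclideanSpace.basisFun (Fin n) ℝ i) -
      fderiv ℝ (fderiv ℝ u) x (gradient u x) (gradient u x) / (1 + ‖gradient u x‖ ^ 2) := by
  set b := EuclideanSpace.basisFun (Fin n) ℝ with hb
  set H := fderiv ℝ (fderiv ℝ u) x with hH
  have hsingle : ∀ i, EuclideanSpace.single i (1 : ℝ) = b i := fun i => by simp [hb]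
  have h1 : ∀ i, pd1 u i x = inner ℝ (b i) (gradient u x) := fun i => by
    rw [pd1, hsingle, real_inner_comm, inner_gradient_left]
  have h2 : ∀ i j, pd2 u i j x = H (b i) (b j) := fun i j => by
    have h3 := h.hasFDerivAt_fderiv.clm_apply (hasFDerivAt_const (b j) x)
    have h4 : pd1 u j = fun y => fderiv ℝ u y (b j) := by
      funext y
      rw [pd1, hsingle]
    rw [pd2, h4, h3.fderiv, hsingle]
    simp [hH]
  have hHG : H (gradient u x) (gradient u x) =
      ∑ i, ∑ j, inner ℝ (b i) (gradient u x) * (inner ℝ (b j) (gradient u x) * H (b i) (b j)) := by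
    conv_lhs => rw [← b.sum_repr' (gradient u x)]
    simp only [map_sum, map_smul, sum_apply, smul_apply, smul_eq_mul, Finset.mul_sum]
    rw [Finset.sum_comm]
    refine Finset.sum_congr rfl fun i _ => Finset.sum_congr rfl fun j _ => ?_
    ring
  have h5 : ∀ i, H (b i) (b i) = ∑ j, (if i = j then (1 : ℝ) else 0) * H (b i) (b j) := fun i => by
    simp
  rw [mcOp, hHG, Finset.sum_div, ← Finset.sum_sub_distrib]
  refine Finset.sum_congr rfl fun i _ => ?_
  rw [h5 i, Finset.sum_div, ← Finset.sum_sub_distrib]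
  refine Finset.sum_congr rfl fun j _ => ?_
  rw [aCoef, h1, h1, h2]
  ring

theorem ContDiff.continuous_gradient {E : Type*} [NormedAddCommGroup E] [InnerProductSpace ℝ E]
    [CompleteSpace E] {u : E → ℝ} (hu : ContDiff ℝ 1 u) : Continuous (gradient u) :=
  (InnerProductSpace.toDual ℝ E).symm.continuous.comp (hu.continuous_fderiv (by norm_num))

/-- If `v` satisfies an a priori bound at each interior weighted maximum, it satisfies it at every
point. -/
theorem weighted_bound_of_bound_at_max {E : Type*} [NormedAddCommGroup E] [InnerProductSpace ℝ E]
    [ProperSpace E] {v : E → ℝ} {θ R M : ℝ} (hv : Continuous v) (hv0 : ∀ x, 0 ≤ v x) (hθ : 0 < θ)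
    (hbound : ∀ x, ‖x‖ < R → 0 < v x →
      IsLocalMax (fun y => log (v y) + 2 / θ * log (R ^ 2 - ‖y‖ ^ 2)) x →
        v x ^ θ * (R ^ 2 - ‖x‖ ^ 2) ^ 2 ≤ M) {x : E} (hx : ‖x‖ < R) (hvx : 0 < v x) :
    v x ^ θ * (R ^ 2 - ‖x‖ ^ 2) ^ 2 ≤ M := by
  have hpos : ∀ y : E, ‖y‖ < R → 0 < R ^ 2 - ‖y‖ ^ 2 := fun y hy => by
    nlinarith [norm_nonneg y]
  set φ : E → ℝ := fun y => v y ^ θ * (R ^ 2 - ‖y‖ ^ 2) ^ 2 with hφ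
  have hφc : Continuous φ :=
    (hv.rpow_const fun y => Or.inr hθ.le).mul (by fun_prop)
  obtain ⟨z, hz, hzmax⟩ := (isCompact_closedBall (0 : E) R).exists_isMaxOn
    ⟨x, by simpa using hx.le⟩ hφc.continuousOn
  have hxz : φ x ≤ φ z := hzmax (by simpa using hx.le)
  have hφx : 0 < φ x := mul_pos (Real.rpow_pos_of_pos hvx _) (pow_pos (hpos x hx) 2)
  have hφz : 0 < φ z := hφx.trans_le hxz
  have hz' : ‖z‖ ≤ R := by simpa using hz
  have hzR : ‖z‖ < R := by
    refine lt_of_le_of_ne hz' fun h => ?_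
    simp [hφ, h] at hφz
  have hvz : 0 < v z := by
    refine lt_of_le_of_ne (hv0 z) fun h => ?_
    simp [hφ, ← h, Real.zero_rpow hθ.ne'] at hφz
  refine hxz.trans (hbound z hzR hvz ?_)
  have hlog : ∀ y : E, ‖y‖ < R → 0 < v y →
      log (v y) + 2 / θ * log (R ^ 2 - ‖y‖ ^ 2) = log (φ y) / θ := fun y hy hvy => by
    rw [hφ]
    simp only
    rw [Real.log_mul (Real.rpow_pos_of_pos hvy _).ne' (pow_pos (hpos y hy) 2).ne',
      Real.log_rpow hvy, Real.log_pow]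
    field_simp
    push_cast
    ring
  filter_upwards [continuous_norm.continuousAt.eventually (gt_mem_nhds hzR),
    hv.continuousAt.eventually (lt_mem_nhds hvz)] with y hy hvy
  rw [hlog y hy hvy, hlog z hzR hvz]
  have hφy : 0 < φ y := mul_pos (Real.rpow_pos_of_pos hvy _) (pow_pos (hpos y hy) 2)
  have : φ y ≤ φ z := hzmax (by simpa using hy.le)
  gcongr

/-- Liouville theorem (E1): entire solutions of
`div(∇u/√(1+|∇u|²)) = |∇u|^θ`, `θ > 0`, are constant. -/
theorem liouville_E1 (n : ℕ) (hn : 1 ≤ n) (θ : ℝ) (hθ : 0 < θ)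
    (u : EuclideanSpace ℝ (Fin n) → ℝ)
    (hu1 : ContDiff ℝ 1 u)
    (hu3 : ContDiffOn ℝ 3 u {x | gradient u x ≠ 0})
    (heq : ∀ x : EuclideanSpace ℝ (Fin n), gradient u x ≠ 0 →
      mcOp u x = Real.sqrt (1 + ‖gradient u x‖ ^ 2) * ‖gradient u x‖ ^ θ) :
    ∃ c : ℝ, ∀ x, u x = c := by
  set b := EuclideanSpace.basisFun (Fin n) ℝ with hb
  have hGc : Continuous (gradient u) := hu1.continuous_gradient
  have hopen : IsOpen {x | gradient u x ≠ 0} := isOpen_ne_fun hGc continuous_const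
  have hC3 : ∀ x, gradient u x ≠ 0 → ContDiffAt ℝ 3 u x := fun x hx =>
    hu3.contDiffAt (hopen.mem_nhds hx)
  have heq' : ∀ x, gradient u x ≠ 0 → ∀ᶠ y in nhds x, ∑ i, fderiv ℝ (fderiv ℝ u) y (b i) (b i) -
      fderiv ℝ (fderiv ℝ u) y (gradient u y) (gradient u y) / (1 + ‖gradient u y‖ ^ 2) =
        √(1 + ‖gradient u y‖ ^ 2) * (‖gradient u y‖ ^ 2) ^ (θ / 2) := fun x hx => by
    filter_upwards [hopen.mem_nhds hx] with y hy
    rw [← mcOp_eq_sum_fderiv (hC3 y hy), heq y hy, ← Real.rpow_natCast,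
      ← Real.rpow_mul (norm_nonneg _)]
    congr 2
    push_cast
    ring
  obtain ⟨C, hC⟩ : ∃ C : ℝ, ∀ R x, ‖x‖ < R → gradient u x ≠ 0 →
      (‖gradient u x‖ ^ 2) ^ θ * (R ^ 2 - ‖x‖ ^ 2) ^ 2 ≤ C * R ^ 2 := by
    refine ⟨(Fintype.card (Fin n) * (θ + 1) * (2 / θ)) ^ 2 +
      Fintype.card (Fin n) ^ 2 * (4 * (2 / θ) ^ 2 + 6 * (2 / θ)),
      fun R x hx hG => weighted_bound_of_bound_at_max (hGc.norm.pow 2)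
      (fun y => sq_nonneg _) hθ (fun y hy hvy hmax => ?_) hx (pow_pos (norm_pos_iff.mpr hG) 2)⟩
    have hGy : gradient u y ≠ 0 := fun h => by simp [h] at hvy
    exact gradient_bound_at_weighted_max b hθ (by positivity) hy hGy (hC3 y hGy) (heq' y hGy) hmax
  have hzero : ∀ x, gradient u x = 0 := by
    intro x
    by_contra hG
    set p := (‖gradient u x‖ ^ 2) ^ θ with hp
    have hp0 : 0 < p := Real.rpow_pos_of_pos (by positivity) _
    set R := 2 * ‖x‖ + 1 + 2 * |C| / p with hR
    have hD : 0 ≤ 2 * |C| / p := by positivity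
    have hx0 := norm_nonneg x
    have hR1 : 1 ≤ R := by linarith
    have h1 := hC R x (by linarith) hG
    have h2 : 3 / 4 * R ^ 2 ≤ R ^ 2 - ‖x‖ ^ 2 := by nlinarith
    have h3 : p * (3 / 4 * R ^ 2) ^ 2 ≤ C * R ^ 2 := le_trans (by gcongr) h1
    have h4 : p * R ^ 2 * (9 / 16) ≤ C := by
      refine le_of_mul_le_mul_right (a := R ^ 2) ?_ (by positivity)
      linarith
    have h5 : p + 2 * |C| ≤ p * R := by
      have : p * (2 * |C| / p) = 2 * |C| := by field_simp
      rw [hR, mul_add, this]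
      nlinarith
    have h6 : p * R ≤ p * R ^ 2 := by gcongr; nlinarith
    have := le_abs_self C
    have := abs_nonneg C
    linarith
  refine ⟨u 0, fun x => is_const_of_fderiv_eq_zero (hu1.differentiable (by norm_num)) (fun y => ?_)
    x 0⟩
  simpa [gradient] using hzero y
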